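/- Let X be a real random variable on a probability space and let σ : ℝ → ℝ be Borel measurable. Suppose there exist an integer n ≥ 1 with n < 1/(a is not needed; n arbitrary), exponents 0 < α < a < 1 with n > a, and a constant C > 0 such that for every bounded α-Hölder continuous function φ : ℝ → ℝ and every h with |h| ≤ 1, |E[|σ(X)|^n (Δ_h^n φ)(X)]| ≤ C ‖φ‖_{C^α_b} |h|^a. Then the restriction of the law of X to the set {y ∈ ℝ : σ(y) ≠ 0} is absolutely continuous with respect to Lebesgue measure; in particular the law of X admits a density on {σ ≠ 0}. -/

import Mathlib

open MeasureTheory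

/-- n-th order finite difference: `(Δ_h^n φ)(x) = ∑_{j=0}^n (-1)^{n-j} (n choose j) φ(x + j h)`. -/
noncomputable def fdiff (n : ℕ) (h : ℝ) (φ : ℝ → ℝ) (x : ℝ) : ℝ :=
  ∑ j ∈ Finset.range (n + 1), (-1 : ℝ) ^ (n - j) * (n.choose j : ℝ) * φ (x + (j : ℝ) * h)

noncomputable def TT (n : ℕ) (c : ℕ → ℝ) (ε : ℝ) (φ : ℝ → ℝ) (x : ℝ) : ℝ :=
  ∫ u in (0:ℝ)..1, ∑ j ∈ Finset.range n, c j * φ (x + (((j:ℝ)+1)*ε)*u)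

lemma TT_cont (n : ℕ) (c : ℕ → ℝ) (ε : ℝ) (φ : ℝ → ℝ) (hφ : Continuous φ) :
    Continuous (TT n c ε φ) := by
  unfold TT
  apply intervalIntegral.continuous_parametric_intervalIntegral_of_continuous'
  fun_prop

lemma TT_comm (n : ℕ) (c : ℕ → ℝ) (ε δ : ℝ) (φ : ℝ → ℝ) (hφ : Continuous φ) :
    TT n c ε (TT n c δ φ) = TT n c δ (TT n c ε φ) := by
  have key : ∀ ε δ x, TT n c ε (TT n c δ φ) x = ∫ u in (0:ℝ)..1, ∫ v in (0:ℝ)..1,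
      ∑ j ∈ Finset.range n, ∑ i ∈ Finset.range n,
        c j * (c i * φ (x + (((j:ℝ)+1)*ε)*u + (((i:ℝ)+1)*δ)*v)) := by
    intro ε δ x
    unfold TT
    congr 1
    ext u
    rw [intervalIntegral.integral_finsetSum]
    · refine Finset.sum_congr rfl fun j _ => ?_
      rw [← intervalIntegral.integral_const_mul]
      simp only [Finset.mul_sum]
    · intro i _
      apply Continuous.intervalIntegrable
      fun_prop
  ext x
  rw [key, key, MeasureTheory.intervalIntegral_intervalIntegral_swap]
  · congr 1
    ext u
    congr 1
    ext v
    rw [Finset.sum_comm]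
    refine Finset.sum_congr rfl fun j _ => Finset.sum_congr rfl fun i _ => ?_
    rw [show x + (((i:ℝ)+1)*ε)*v + (((j:ℝ)+1)*δ)*u = x + (((j:ℝ)+1)*δ)*u + (((i:ℝ)+1)*ε)*v by ring]
    ring
  · have : Continuous (fun p : ℝ × ℝ => ∑ j ∈ Finset.range n, ∑ i ∈ Finset.range n,
        c j * (c i * φ (x + (((j:ℝ)+1)*ε)*p.1 + (((i:ℝ)+1)*δ)*p.2))) := by fun_prop
    exact (this.continuousOn.integrableOn_compact
      (isCompact_uIcc.prod isCompact_uIcc)).mono_set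
      (Set.prod_mono Set.uIoc_subset_uIcc Set.uIoc_subset_uIcc)

lemma TT_bdd (n : ℕ) (c : ℕ → ℝ) (ε : ℝ) (φ : ℝ → ℝ) (M : ℝ) (hM : ∀ x, |φ x| ≤ M) (x : ℝ) :
    |TT n c ε φ x| ≤ (∑ j ∈ Finset.range n, |c j|) * M := by
  unfold TT
  have := intervalIntegral.norm_integral_le_of_norm_le_const (a := (0:ℝ)) (b := 1)
    (f := fun u => ∑ j ∈ Finset.range n, c j * φ (x + (((j:ℝ)+1)*ε)*u))
    (C := (∑ j ∈ Finset.range n, |c j|) * M) ?_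
  · simpa using this
  · intro u _
    rw [Finset.sum_mul]
    refine (norm_sum_le _ _).trans (Finset.sum_le_sum fun j _ => ?_)
    rw [Real.norm_eq_abs, abs_mul]
    exact mul_le_mul_of_nonneg_left (hM _) (abs_nonneg _)

lemma TT_eq (n : ℕ) (c : ℕ → ℝ) (ε : ℝ) (hε : 0 < ε) (φ : ℝ → ℝ) (hφ : Continuous φ) (x : ℝ) :
    TT n c ε φ x = ∑ j ∈ Finset.range n, c j * ((((j:ℝ)+1)*ε)⁻¹ *
      ∫ t in x..(x + (((j:ℝ)+1)*ε)), φ t) := by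
  unfold TT
  rw [intervalIntegral.integral_finsetSum]
  · refine Finset.sum_congr rfl fun j _ => ?_
    rw [intervalIntegral.integral_const_mul, intervalIntegral.integral_comp_add_mul]
    · simp
    · positivity
  · intro i _
    apply Continuous.intervalIntegrable
    fun_prop

lemma le_aux (j : ℕ) (ε : ℝ) (hε : 0 < ε) : ε ≤ ((j:ℝ)+1)*ε := by
  have : (0:ℝ) ≤ j := Nat.cast_nonneg j
  nlinarith

lemma TT_lip (n : ℕ) (c : ℕ → ℝ) (ε : ℝ) (hε : 0 < ε) (φ : ℝ → ℝ) (hφ : Continuous φ)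
    (M : ℝ) (hM : ∀ x, |φ x| ≤ M) (x y : ℝ) :
    |TT n c ε φ x - TT n c ε φ y| ≤ (2 * (∑ j ∈ Finset.range n, |c j|) * M) * (|x - y| / ε) := by
  rw [TT_eq n c ε hε φ hφ, TT_eq n c ε hε φ hφ, ← Finset.sum_sub_distrib, Finset.mul_sum,
    Finset.sum_mul, Finset.sum_mul]
  refine (Finset.abs_sum_le_sum_abs _ _).trans (Finset.sum_le_sum fun j _ => ?_)
  have hM0 : 0 ≤ M := (abs_nonneg _).trans (hM 0)
  rw [← mul_sub, ← mul_sub, intervalIntegral.integral_interval_sub_interval_comm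
    (hφ.intervalIntegrable _ _) (hφ.intervalIntegrable _ _) (hφ.intervalIntegrable _ _),
    abs_mul, abs_mul, abs_of_pos (show 0 < (((j:ℝ)+1)*ε)⁻¹ by positivity)]
  have h1 : ∀ p q, |∫ t in p..q, φ t| ≤ M * |q - p| := fun p q => by
    simpa using intervalIntegral.norm_integral_le_of_norm_le_const (a := p) (b := q) (f := φ)
      (C := M) (fun t _ => hM t)
  have h2 : |(∫ t in x..y, φ t) - ∫ t in (x + ((j:ℝ)+1)*ε)..(y + ((j:ℝ)+1)*ε), φ t|
      ≤ 2 * M * |x - y| := by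
    refine (abs_sub _ _).trans ?_
    have a1 := h1 x y
    have a2 := h1 (x + ((j:ℝ)+1)*ε) (y + ((j:ℝ)+1)*ε)
    rw [show y + ((j:ℝ)+1)*ε - (x + ((j:ℝ)+1)*ε) = y - x by ring] at a2
    rw [abs_sub_comm x y]
    linarith
  calc _ ≤ |c j| * (ε⁻¹ * (2 * M * |x - y|)) := by
        gcongr
        exact le_aux j ε hε
    _ = _ := by ring

lemma TT_L1 (n : ℕ) (c : ℕ → ℝ) (ε : ℝ) (hε : 0 < ε) (φ : ℝ → ℝ) (hφ : Continuous φ)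
    (h0 : ∀ x, 0 ≤ φ x) (hi : Integrable φ) (x : ℝ) :
    |TT n c ε φ x| ≤ (∑ j ∈ Finset.range n, |c j|) * (ε⁻¹ * ∫ t, φ t) := by
  rw [TT_eq n c ε hε φ hφ, Finset.sum_mul]
  refine (Finset.abs_sum_le_sum_abs _ _).trans (Finset.sum_le_sum fun j _ => ?_)
  have hx : x ≤ x + ((j:ℝ)+1)*ε := by
    have : 0 < ((j:ℝ)+1)*ε := by positivity
    linarith
  have h1 : ∫ t in x..(x + ((j:ℝ)+1)*ε), φ t ≤ ∫ t, φ t := by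
    rw [intervalIntegral.integral_of_le hx]
    exact setIntegral_le_integral hi (Filter.Eventually.of_forall h0)
  have h2 : 0 ≤ ∫ t in x..(x + ((j:ℝ)+1)*ε), φ t :=
    intervalIntegral.integral_nonneg hx fun t _ => h0 t
  rw [abs_mul, abs_mul, abs_of_pos (show 0 < (((j:ℝ)+1)*ε)⁻¹ by positivity), abs_of_nonneg h2]
  gcongr
  exact le_aux j ε hε

lemma min_aux (α t B D : ℝ) (hα : 0 < α) (hα1 : α < 1) (ht : 0 ≤ t) (hB : 0 ≤ B)
    (h1 : D ≤ B) (h2 : D ≤ B * t) : D ≤ B * t ^ α := by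
  rcases le_total t 1 with h | h
  · refine h2.trans (mul_le_mul_of_nonneg_left ?_ hB)
    simpa using Real.rpow_le_rpow_of_exponent_ge_of_imp ht h hα1.le (by intro _ h; linarith)
  · refine h1.trans (le_mul_of_one_le_right hB (Real.one_le_rpow h hα.le))

lemma TT_holder (n : ℕ) (c : ℕ → ℝ) (ε : ℝ) (hε : 0 < ε) (φ : ℝ → ℝ) (hφ : Continuous φ)
    (α : ℝ) (hα : 0 < α) (hα1 : α < 1)
    (M : ℝ) (hM : ∀ x, |φ x| ≤ M) (x y : ℝ) :
    |TT n c ε φ x - TT n c ε φ y| ≤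
      (2 * (∑ j ∈ Finset.range n, |c j|) * M * ε ^ (-α)) * |x - y| ^ α := by
  have hM0 : 0 ≤ M := (abs_nonneg _).trans (hM 0)
  have hS : 0 ≤ ∑ j ∈ Finset.range n, |c j| := Finset.sum_nonneg fun _ _ => abs_nonneg _
  have := min_aux α (|x-y|/ε) (2 * (∑ j ∈ Finset.range n, |c j|) * M) _ hα hα1 (by positivity)
    (by positivity) ?_ (TT_lip n c ε hε φ hφ M hM x y)
  · rw [Real.div_rpow (abs_nonneg _) hε.le, div_eq_mul_inv, ← Real.rpow_neg hε.le] at this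
    linarith
  · have a1 := TT_bdd n c ε φ M hM x
    have a2 := TT_bdd n c ε φ M hM y
    have := abs_sub (TT n c ε φ x) (TT n c ε φ y)
    linarith

/-- coefficients -/
noncomputable def cc (n j : ℕ) : ℝ := -((-1) ^ n * ((-1 : ℝ) ^ (n - (j+1)) * (n.choose (j+1) : ℝ)))

lemma fdiff_eq (n : ℕ) (h : ℝ) (φ : ℝ → ℝ) (x : ℝ) :
    (-1 : ℝ) ^ n * fdiff n h φ x =
      φ x - ∑ j ∈ Finset.range n, cc n j * φ (x + ((j:ℝ)+1)*h) := by
  unfold fdiff cc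
  rw [Finset.sum_range_succ', mul_add, Finset.mul_sum]
  have : (-1:ℝ)^n * (-1)^n = 1 := by rw [← mul_pow]; simp
  simp only [Nat.cast_add, Nat.cast_one, Nat.sub_zero, Nat.choose_zero_right, Nat.cast_zero,
    zero_mul, add_zero, mul_one, neg_mul, Finset.sum_neg_distrib, sub_neg_eq_add]
  rw [← mul_assoc, this, one_mul, add_comm]
  congr 1
  refine Finset.sum_congr rfl fun j _ => by ring

lemma F_TT (κ : Measure ℝ) [IsFiniteMeasure κ] (n : ℕ) (α a C : ℝ) (ha : 0 < a) (hC : 0 < C)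
    (hα : 0 < α)
    (H : ∀ φ : ℝ → ℝ, ∀ M K : ℝ, Continuous φ → (∀ x, |φ x| ≤ M) →
      (∀ x y, |φ x - φ y| ≤ K * |x - y| ^ α) →
      ∀ h : ℝ, |h| ≤ 1 → |∫ x, fdiff n h φ x ∂κ| ≤ C * (M + K) * |h| ^ a)
    (φ : ℝ → ℝ) (M K : ℝ) (hφ : Continuous φ) (hM : ∀ x, |φ x| ≤ M)
    (hK : ∀ x y, |φ x - φ y| ≤ K * |x - y| ^ α) (ε : ℝ) (hε : 0 < ε) (hε1 : ε ≤ 1) :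
    |(∫ x, φ x ∂κ) - ∫ x, TT n (cc n) ε φ x ∂κ| ≤ C * (M + K) * ε ^ a := by
  have hM0 : 0 ≤ M := (abs_nonneg _).trans (hM 0)
  have hK0 : 0 ≤ K := by
    have := (abs_nonneg _).trans (hK 0 1)
    simpa using this
  have bi : ∀ (f : ℝ → ℝ) (B : ℝ), Continuous f → (∀ x, |f x| ≤ B) → Integrable f κ :=
    fun f B hf hB => Integrable.of_bound hf.aestronglyMeasurable B
      (Filter.Eventually.of_forall hB)
  have hfc : Continuous (fun p : ℝ × ℝ => fdiff n (ε * p.1) φ p.2) := by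
    unfold fdiff; fun_prop
  rw [← integral_sub (bi _ _ hφ hM) (bi _ _ (TT_cont n _ ε φ hφ) (TT_bdd n _ ε φ M hM))]
  have e1 : ∀ x, φ x - TT n (cc n) ε φ x =
      ∫ u in (0:ℝ)..1, (-1:ℝ)^n * fdiff n (ε * u) φ x := by
    intro x
    simp only [fdiff_eq]
    rw [intervalIntegral.integral_sub]
    · simp [TT, mul_assoc]
    · simp
    · apply Continuous.intervalIntegrable
      fun_prop
  simp only [e1]
  rw [← MeasureTheory.intervalIntegral_integral_swap]
  · have := intervalIntegral.norm_integral_le_of_norm_le_const (a := (0:ℝ)) (b := 1)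
      (f := fun u => ∫ x, (-1:ℝ)^n * fdiff n (ε * u) φ x ∂κ)
      (C := C * (M + K) * ε ^ a) ?_
    · simpa using this
    · intro u hu
      rw [Set.uIoc_of_le zero_le_one] at hu
      have hb : |ε * u| ≤ ε := by
        rw [abs_of_nonneg (mul_nonneg hε.le hu.1.le)]
        nlinarith [hu.2]
      rw [integral_const_mul, Real.norm_eq_abs, abs_mul, abs_pow]
      simp only [abs_neg, abs_one, one_pow, one_mul]
      refine (H φ M K hφ hM hK (ε * u) (hb.trans hε1)).trans ?_
      gcongr
  · haveI : IsFiniteMeasure ((volume : Measure ℝ).restrict (Set.uIoc 0 1)) := by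
      rw [Set.uIoc_of_le zero_le_one]; infer_instance
    apply Integrable.of_bound (C := M + (∑ j ∈ Finset.range n, |cc n j|) * M)
    · apply Continuous.aestronglyMeasurable
      exact continuous_const.mul hfc
    · refine Filter.Eventually.of_forall fun p => ?_
      simp only [Function.uncurry, fdiff_eq, Real.norm_eq_abs]
      refine (abs_sub _ _).trans (add_le_add (hM _) ?_)
      rw [Finset.sum_mul]
      refine (Finset.abs_sum_le_sum_abs _ _).trans (Finset.sum_le_sum fun j _ => ?_)
      rw [abs_mul]
      exact mul_le_mul_of_nonneg_left (hM _) (abs_nonneg _)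


lemma F_geom (κ : Measure ℝ) [IsFiniteMeasure κ] (n : ℕ) (α a C : ℝ) (hα : 0 < α) (hαa : α < a)
    (ha : a < 1) (hC : 0 < C)
    (H : ∀ φ : ℝ → ℝ, ∀ M K : ℝ, Continuous φ → (∀ x, |φ x| ≤ M) →
      (∀ x y, |φ x - φ y| ≤ K * |x - y| ^ α) →
      ∀ h : ℝ, |h| ≤ 1 → |∫ x, fdiff n h φ x ∂κ| ≤ C * (M + K) * |h| ^ a)
    (φ : ℝ → ℝ) (K : ℝ) (hφ : Continuous φ) (hM : ∀ x, |φ x| ≤ 1)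
    (hK : ∀ x y, |φ x - φ y| ≤ K * |x - y| ^ α) (k : ℕ) :
    |(∫ x, TT n (cc n) ((1/2) ^ k) φ x ∂κ) - ∫ x, φ x ∂κ| ≤
      8 * C * (∑ j ∈ Finset.range n, |cc n j|) * ((1/2 : ℝ) ^ (a - α)) ^ k
        / (1 - (1/2 : ℝ) ^ (a - α)) := by
  have ha0 : 0 < a := hα.trans hαa
  have hα1 : α < 1 := hαa.trans ha
  set S := ∑ j ∈ Finset.range n, |cc n j| with hS
  have hS0 : 0 ≤ S := Finset.sum_nonneg fun _ _ => abs_nonneg _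
  have hp0 : ∀ k : ℕ, (0:ℝ) < (1/2) ^ k := fun k => by positivity
  have hp1 : ∀ k : ℕ, ((1:ℝ)/2) ^ k ≤ 1 := fun k => pow_le_one₀ (by norm_num) (by norm_num)
  have hr : (1/2 : ℝ) ^ (a - α) < 1 :=
    Real.rpow_lt_one (by norm_num) (by norm_num) (by linarith)
  have key : ∀ k l : ℕ, |(∫ x, TT n (cc n) ((1/2) ^ k) φ x ∂κ) -
      ∫ x, TT n (cc n) ((1/2) ^ l) (TT n (cc n) ((1/2) ^ k) φ) x ∂κ| ≤
      C * (S * 1 + 2 * S * 1 * (((1:ℝ)/2) ^ k) ^ (-α)) * (((1:ℝ)/2) ^ l) ^ a := fun k l =>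
    F_TT κ n α a C ha0 hC hα H _ _ _ (TT_cont n _ _ φ hφ) (TT_bdd n _ _ φ 1 hM)
      (TT_holder n _ _ (hp0 k) φ hφ α hα hα1 1 hM) _ (hp0 l) (hp1 l)
  refine dist_le_of_le_geometric_of_tendsto
    (f := fun k : ℕ => ∫ x, TT n (cc n) ((1/2) ^ k) φ x ∂κ)
    ((1/2 : ℝ) ^ (a - α)) (8 * C * S) hr ?_ ?_ k
  · intro k
    have k1 := key k (k+1)
    have k2 := key (k+1) k
    rw [TT_comm n _ _ _ φ hφ] at k1
    rw [Real.dist_eq]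
    have e1 : (((1:ℝ)/2) ^ (k+1)) ^ (-α) ≤ 2 * (((1:ℝ)/2) ^ k) ^ (-α) := by
      rw [pow_succ, Real.mul_rpow (hp0 k).le (by norm_num), mul_comm]
      gcongr
      rw [Real.rpow_neg (by norm_num), ← Real.inv_rpow (by norm_num)]
      norm_num
      simpa using Real.rpow_le_rpow_of_exponent_le (x := 2) (by norm_num) hα1.le
    have e2 : (((1:ℝ)/2) ^ (k+1)) ^ a ≤ (((1:ℝ)/2) ^ k) ^ a := by
      refine Real.rpow_le_rpow (hp0 _).le ?_ ha0.le
      rw [pow_succ]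
      linarith [hp0 k]
    have e3 : 1 ≤ (((1:ℝ)/2) ^ k) ^ (-α) :=
      Real.one_le_rpow_of_pos_of_le_one_of_nonpos (hp0 k) (hp1 k) (by linarith)
    have e4 : ((1/2 : ℝ) ^ (a - α)) ^ k = (((1:ℝ)/2) ^ k) ^ (-α) * (((1:ℝ)/2) ^ k) ^ a := by
      rw [← Real.rpow_add (hp0 k), ← Real.rpow_natCast, ← Real.rpow_natCast,
        ← Real.rpow_mul (by norm_num), ← Real.rpow_mul (by norm_num)]
      congr 1; ring
    rw [e4]
    have e5 : 0 < (((1:ℝ)/2) ^ k) ^ a := Real.rpow_pos_of_pos (hp0 k) _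
    set Q := (((1:ℝ)/2) ^ k) ^ (-α)
    set A := (((1:ℝ)/2) ^ k) ^ a
    have k1' : C * (S * 1 + 2 * S * 1 * Q) * (((1:ℝ)/2) ^ (k+1)) ^ a ≤
        C * (S * Q + 2 * S * 1 * Q) * A := by gcongr
    have k2' : C * (S * 1 + 2 * S * 1 * (((1:ℝ)/2) ^ (k+1)) ^ (-α)) * A ≤
        C * (S * Q + 2 * S * 1 * (2 * Q)) * A := by gcongr
    refine (abs_sub_le _ _ _).trans (add_le_add (k1.trans k1')
      ((abs_sub_comm _ _).trans_le (k2.trans k2'))) |>.trans (le_of_eq ?_)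
    ring
  · rw [tendsto_iff_dist_tendsto_zero]
    have hK0 : 0 ≤ K := by simpa using (abs_nonneg _).trans (hK 0 1)
    refine squeeze_zero (fun _ => dist_nonneg) (g := fun k : ℕ => C * (1 + K) * ((1/2 : ℝ) ^ a) ^ k)
      (fun k => ?_) ?_
    · rw [dist_comm, Real.dist_eq]
      refine (F_TT κ n α a C ha0 hC hα H φ 1 K hφ hM hK _ (hp0 k) (hp1 k)).trans (le_of_eq ?_)
      rw [← Real.rpow_natCast, ← Real.rpow_natCast,
        ← Real.rpow_mul (by norm_num), ← Real.rpow_mul (by norm_num), mul_comm a]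
    · rw [← mul_zero (C * (1 + K))]
      exact (tendsto_pow_atTop_nhds_zero_of_lt_one (by positivity)
        (Real.rpow_lt_one (by norm_num) (by norm_num) ha0)).const_mul _

lemma kappa_compact (κ : Measure ℝ) [IsFiniteMeasure κ] (n : ℕ) (α a C : ℝ) (hα : 0 < α)
    (hαa : α < a) (ha : a < 1) (hC : 0 < C)
    (H : ∀ φ : ℝ → ℝ, ∀ M K : ℝ, Continuous φ → (∀ x, |φ x| ≤ M) →
      (∀ x y, |φ x - φ y| ≤ K * |x - y| ^ α) →
      ∀ h : ℝ, |h| ≤ 1 → |∫ x, fdiff n h φ x ∂κ| ≤ C * (M + K) * |h| ^ a)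
    (N : Set ℝ) (hN : IsCompact N) (hN0 : volume N = 0) : κ N = 0 := by
  rcases N.eq_empty_or_nonempty with rfl | hne
  · simp
  set S := ∑ j ∈ Finset.range n, |cc n j| with hS
  have hS0 : 0 ≤ S := Finset.sum_nonneg fun _ _ => abs_nonneg _
  have hα1 : α < 1 := hαa.trans ha
  have step : ∀ (k : ℕ) (r : ℝ), 0 < r → κ.real N ≤
      S * (((1/2:ℝ)^k)⁻¹ * volume.real (Metric.cthickening r N)) * κ.real Set.univ +
      8 * C * S * ((1/2 : ℝ) ^ (a - α)) ^ k / (1 - (1/2 : ℝ) ^ (a - α)) := by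
    intro k r hr
    let φ : ℝ → ℝ := fun x => max 0 (1 - Metric.infDist x N / r)
    have hc : Continuous φ := by
      have := Metric.continuous_infDist_pt N
      fun_prop
    have h0 : ∀ x, 0 ≤ φ x := fun x => le_max_left _ _
    have h1 : ∀ x, φ x ≤ 1 := fun x => max_le zero_le_one (by
      have : 0 ≤ Metric.infDist x N / r := div_nonneg Metric.infDist_nonneg hr.le
      linarith)
    have hM : ∀ x, |φ x| ≤ 1 := fun x => by rw [abs_of_nonneg (h0 x)]; exact h1 x
    have hN1 : ∀ x ∈ N, φ x = 1 := fun x hx => by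
      simp [φ, Metric.infDist_zero_of_mem hx]
    have hout : ∀ x, x ∉ Metric.cthickening r N → φ x = 0 := fun x hx => by
      have : r < Metric.infDist x N := by
        by_contra hle
        refine hx (Metric.mem_cthickening_iff.2 ?_)
        rw [ENNReal.le_ofReal_iff_toReal_le (Metric.infEDist_ne_top hne) hr.le]
        exact not_lt.1 hle
      refine max_eq_left ?_
      have := (one_lt_div hr).2 this
      linarith
    have hlip : ∀ x y, |φ x - φ y| ≤ |x - y| / r := fun x y => by
      refine (abs_max_sub_max_le_max _ _ _ _).trans ?_
      have : |Metric.infDist x N - Metric.infDist y N| ≤ |x - y| := by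
        simpa [Real.dist_eq] using (Metric.lipschitz_infDist_pt N).dist_le_mul x y
      rw [sub_self, abs_zero, max_eq_right (abs_nonneg _),
        show 1 - Metric.infDist x N / r - (1 - Metric.infDist y N / r) =
          -((Metric.infDist x N - Metric.infDist y N) / r) by ring, abs_neg, abs_div, abs_of_pos hr]
      gcongr
    have hK : ∀ x y, |φ x - φ y| ≤ (r ^ α)⁻¹ * |x - y| ^ α := fun x y => by
      have := min_aux α (|x-y|/r) 1 |φ x - φ y| hα hα1 (by positivity) zero_le_one
        (abs_le.2 ⟨by linarith [h0 x, h1 y], by linarith [h0 y, h1 x]⟩)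
        (by simpa using hlip x y)
      rw [Real.div_rpow (abs_nonneg _) hr.le, one_mul, div_eq_inv_mul] at this
      exact this
    have hfin : volume (Metric.cthickening r N) ≠ ⊤ :=
      hN.isBounded.cthickening.measure_lt_top.ne
    have hms : MeasurableSet (Metric.cthickening r N) := Metric.isClosed_cthickening.measurableSet
    have hind : ∀ x, φ x ≤ (Metric.cthickening r N).indicator (fun _ => (1:ℝ)) x := fun x => by
      by_cases hx : x ∈ Metric.cthickening r N
      · simpa [hx] using h1 x
      · simp [hx, hout x hx]
    have hi1 : Integrable ((Metric.cthickening r N).indicator (fun _ => (1:ℝ))) :=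
      (integrable_indicator_iff hms).2 (integrableOn_const hfin)
    have hi : Integrable φ := hi1.mono' hc.aestronglyMeasurable
      (Filter.Eventually.of_forall fun x => by
        rw [Real.norm_eq_abs, abs_of_nonneg (h0 x)]; exact hind x)
    have hI : ∫ x, φ x ≤ volume.real (Metric.cthickening r N) := by
      refine (integral_mono hi hi1 hind).trans (le_of_eq ?_)
      rw [integral_indicator hms]; simp
    have hT : |∫ x, TT n (cc n) ((1/2) ^ k) φ x ∂κ| ≤
        S * (((1/2:ℝ)^k)⁻¹ * volume.real (Metric.cthickening r N)) * κ.real Set.univ := by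
      rw [← Real.norm_eq_abs]
      refine norm_integral_le_of_norm_le_const (Filter.Eventually.of_forall fun x => ?_)
      refine (TT_L1 n (cc n) ((1/2)^k) (by positivity) φ hc h0 hi x).trans ?_
      gcongr
    have hG := F_geom κ n α a C hα hαa ha hC H φ _ hc hM hK k
    have hNκ : κ.real N ≤ ∫ x, φ x ∂κ := by
      rw [← integral_indicator_one hN.measurableSet]
      refine integral_mono ((integrable_indicator_iff hN.measurableSet).2
        (integrableOn_const (measure_ne_top _ _))) ?_ fun x => ?_
      · exact Integrable.of_bound hc.aestronglyMeasurable 1 (Filter.Eventually.of_forall hM)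
      · by_cases hx : x ∈ N
        · simp [hx, hN1 x hx]
        · simpa [hx] using h0 x
    have := abs_le.1 hT
    have := abs_le.1 hG
    linarith [this.1]
  have hv : Filter.Tendsto (fun r => volume.real (Metric.cthickening r N))
      (nhdsWithin 0 (Set.Ioi 0)) (nhds 0) := by
    have := (tendsto_measure_cthickening_of_isCompact (μ := volume) hN)
    rw [hN0] at this
    exact ((ENNReal.tendsto_toReal ENNReal.zero_ne_top).comp this).mono_left nhdsWithin_le_nhds
  have step2 : ∀ k : ℕ, κ.real N ≤
      8 * C * S * ((1/2 : ℝ) ^ (a - α)) ^ k / (1 - (1/2 : ℝ) ^ (a - α)) := by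
    intro k
    have t := (((hv.const_mul ((1/2:ℝ)^k)⁻¹).const_mul S).mul_const (κ.real Set.univ)).add_const
      (8 * C * S * ((1/2 : ℝ) ^ (a - α)) ^ k / (1 - (1/2 : ℝ) ^ (a - α)))
    simp only [mul_zero, zero_mul, zero_add] at t
    refine ge_of_tendsto t ?_
    filter_upwards [self_mem_nhdsWithin] with r hr using step k r hr
  have t2 : Filter.Tendsto (fun k : ℕ => 8 * C * S * ((1/2 : ℝ) ^ (a - α)) ^ k /
      (1 - (1/2 : ℝ) ^ (a - α))) Filter.atTop (nhds 0) := by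
    have := ((tendsto_pow_atTop_nhds_zero_of_lt_one (r := (1/2 : ℝ) ^ (a - α)) (by positivity)
      (Real.rpow_lt_one (by norm_num) (by norm_num) (by linarith))).const_mul (8 * C * S)).div_const
        (1 - (1/2 : ℝ) ^ (a - α))
    simpa using this
  have h3 : κ.real N ≤ 0 := ge_of_tendsto' t2 step2
  have h4 : κ.real N = 0 := le_antisymm h3 measureReal_nonneg
  exact (measureReal_eq_zero_iff).1 h4

lemma kappa_ac (κ : Measure ℝ) [IsFiniteMeasure κ] (h : ∀ N, IsCompact N → volume N = 0 → κ N = 0) :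
    κ ≪ volume := by
  refine Measure.AbsolutelyContinuous.mk fun s hs h0 => ?_
  by_contra hne
  obtain ⟨N, hNs, hN, hlt⟩ := hs.exists_lt_isCompact (μ := κ) (pos_iff_ne_zero.2 hne)
  exact hlt.ne' (h N hN (measure_mono_null hNs h0))

/-- the localized Debussche–Romito criterion: the law of `X` restricted to
`{σ ≠ 0}` is absolutely continuous w.r.t. Lebesgue measure. -/
theorem statement14 {Ω : Type*} [MeasurableSpace Ω] (P : Measure Ω) [IsProbabilityMeasure P]
    (X : Ω → ℝ) (hX : Measurable X) (σ : ℝ → ℝ) (hσ : Measurable σ)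
    (n : ℕ) (α a C : ℝ)
    (hn : 1 ≤ n) (hα : 0 < α) (hαa : α < a) (ha : a < 1) (hna : a < (n : ℝ)) (hC : 0 < C)
    (hint : Integrable (fun ω => |σ (X ω)| ^ n) P)
    (H : ∀ φ : ℝ → ℝ, ∀ M K : ℝ,
      (∀ x, |φ x| ≤ M) →
      (∀ x y, |φ x - φ y| ≤ K * |x - y| ^ α) →
      ∀ h : ℝ, |h| ≤ 1 →
        |∫ ω, |σ (X ω)| ^ n * fdiff n h φ (X ω) ∂P| ≤ C * (M + K) * |h| ^ a) :
    ((Measure.map X P).restrict {y : ℝ | σ y ≠ 0}).AbsolutelyContinuous volume := by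
  set f : ℝ → ENNReal := fun y => ENNReal.ofReal (|σ y| ^ n) with hf
  have hfm : Measurable f := by
    have : Measurable fun y => |σ y| ^ n := (hσ.abs).pow_const n
    exact this.ennreal_ofReal
  have hF : ∀ g : ℝ → ℝ, Continuous g → ∫ y, g y ∂((Measure.map X P).withDensity f) =
      ∫ ω, |σ (X ω)| ^ n * g (X ω) ∂P := by
    intro g hg
    rw [integral_withDensity_eq_integral_toReal_smul hfm
      (Filter.Eventually.of_forall fun _ => ENNReal.ofReal_lt_top), integral_map hX.aemeasurable]
    · refine integral_congr_ae (Filter.Eventually.of_forall fun ω => ?_)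
      simp only [hf, smul_eq_mul]
      rw [ENNReal.toReal_ofReal (by positivity)]
    · exact (hfm.ennreal_toReal.smul hg.measurable).aestronglyMeasurable
  haveI : IsFiniteMeasure ((Measure.map X P).withDensity f) := by
    apply isFiniteMeasure_withDensity
    rw [lintegral_map hfm hX]
    exact hint.lintegral_lt_top.ne
  have hac : (Measure.map X P).withDensity f ≪ volume := by
    refine kappa_ac _ fun N hN hN0 =>
      kappa_compact _ n α a C hα hαa ha hC (fun φ M K hφ hM hK h hh => ?_) N hN hN0
    rw [hF _ (by unfold fdiff; fun_prop)]
    exact H φ M K hM hK h hh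
  refine Measure.AbsolutelyContinuous.mk fun s hs h0 => ?_
  have h1 := (withDensity_apply_eq_zero hfm).1 (hac h0)
  rw [Measure.restrict_apply hs]
  refine measure_mono_null ?_ h1
  intro y hy
  refine ⟨?_, hy.1⟩
  have : 0 < |σ y| ^ n := pow_pos (abs_pos.2 hy.2) n
  exact (ENNReal.ofReal_pos.2 this).ne'
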